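/- arXiv:2104.08604 — 4 statements merged into one kernel-verified Lean document; each statement's English description precedes it below -/
import Mathlib

section
/- Let W be an n×m real matrix, let k be a positive integer, and let ε, δ > 0. There exists an absolute constant C > 0 such that if S is a CountSketch matrix of sketch size t = ⌈C·k²/(ε²·δ)⌉, then with probability at least 1 − δ (over the randomness of S), for all vectors θ ∈ ℝ^m simultaneously, |‖S·W·θ‖₂² − ‖W·θ‖₂²| ≤ ε·‖θ‖₂²·(‖W‖₂² + ‖W‖_F²/k), where ‖W‖₂ is the spectral (operator) norm and ‖W‖_F is the Frobenius norm of W. -/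
open Finset Matrix

/-- Sample space for a CountSketch matrix of sketch size `t` on `ℝ^n`: a pair of hash
functions `(h, σ)`, drawn uniformly (and hence fully independently). -/
abbrev CSOmega (n t : ℕ) : Type := (Fin n → Fin t) × (Fin n → Bool)

/-- The CountSketch matrix `S ∈ ℝ^{t×n}` determined by the sample `ω = (h, σ)`:
`S i k = σ(k) · 𝟙[h(k) = i]`. -/
noncomputable def csSketch {n t : ℕ} (ω : CSOmega n t) : Matrix (Fin t) (Fin n) ℝ :=
  fun i k => (if ω.2 k then (1 : ℝ) else -1) * (if ω.1 k = i then 1 else 0)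

/-- Expectation of a real random variable under the uniform distribution on a finite
sample space. -/
noncomputable def unifE {α : Type*} [Fintype α] (f : α → ℝ) : ℝ :=
  (∑ a : α, f a) / (Fintype.card α : ℝ)

open scoped Classical in
/-- Probability of an event under the uniform distribution on a finite sample space. -/
noncomputable def unifPr {α : Type*} [Fintype α] (P : α → Prop) : ℝ :=
  ((Finset.univ.filter P).card : ℝ) / (Fintype.card α : ℝ)

/-- Squared Euclidean norm of a vector in `ℝ^p`. -/
def sqNorm {p : ℕ} (v : Fin p → ℝ) : ℝ := ∑ i, (v i) ^ 2

/-- Squared Frobenius norm of a matrix. -/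
def frobSq {n m : ℕ} (W : Matrix (Fin n) (Fin m) ℝ) : ℝ := ∑ i, ∑ j, (W i j) ^ 2

/-- Spectral (ℓ₂ operator) norm of a matrix: the operator norm of the induced linear map
between Euclidean spaces. -/
noncomputable def specNorm {n m : ℕ} (W : Matrix (Fin n) (Fin m) ℝ) : ℝ :=
  ‖LinearMap.toContinuousLinearMap (Matrix.toEuclideanLin W)‖


/-- random sign -/
noncomputable def csSgn {n t : ℕ} (ω : CSOmega n t) (k : Fin n) : ℝ := if ω.2 k then 1 else -1

/-- off-diagonal part of the Gram matrix of the sketch -/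
noncomputable def csQ {n t : ℕ} (ω : CSOmega n t) (k l : Fin n) : ℝ :=
  if k = l then 0 else csSgn ω k * csSgn ω l * (if ω.1 k = ω.1 l then 1 else 0)

lemma csSgn_sq {n t : ℕ} (ω : CSOmega n t) (k : Fin n) : csSgn ω k * csSgn ω k = 1 := by
  unfold csSgn; split_ifs <;> norm_num

/-- flip the sign at `j` -/
def csFlip {n t : ℕ} (j : Fin n) (ω : CSOmega n t) : CSOmega n t :=
  (ω.1, Function.update ω.2 j (!ω.2 j))

lemma csFlip_inv {n t : ℕ} (j : Fin n) : Function.Involutive (csFlip (n := n) (t := t) j) := by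
  intro ω
  unfold csFlip
  ext x <;> simp

lemma csSgn_flip_self {n t : ℕ} (ω : CSOmega n t) (j : Fin n) :
    csSgn (csFlip j ω) j = - csSgn ω j := by
  unfold csSgn csFlip
  cases h : ω.2 j <;> simp

lemma csSgn_flip_ne {n t : ℕ} (ω : CSOmega n t) (j k : Fin n) (h : k ≠ j) :
    csSgn (csFlip j ω) k = csSgn ω k := by
  unfold csSgn csFlip
  simp [Function.update_of_ne h]

lemma csQ_flip_left {n t : ℕ} (ω : CSOmega n t) (k l : Fin n) :
    csQ (csFlip k ω) k l = - csQ ω k l := by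
  unfold csQ
  by_cases h : k = l
  · simp [h]
  · rw [csSgn_flip_self, csSgn_flip_ne _ _ _ (Ne.symm h), if_neg h, if_neg h]
    have e : (csFlip k ω).1 = ω.1 := rfl
    rw [e]; ring

lemma csQ_comm {n t : ℕ} (ω : CSOmega n t) (k l : Fin n) : csQ ω k l = csQ ω l k := by
  unfold csQ
  simp only [eq_comm (a := k) (b := l), eq_comm (a := ω.1 k), mul_comm (csSgn ω k)]

lemma csQ_flip_ne {n t : ℕ} (ω : CSOmega n t) (j k l : Fin n) (h1 : k ≠ j) (h2 : l ≠ j) :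
    csQ (csFlip j ω) k l = csQ ω k l := by
  unfold csQ
  rw [csSgn_flip_ne _ _ _ h1, csSgn_flip_ne _ _ _ h2]
  rfl

lemma sum_zero_of_flip {n t : ℕ} (j : Fin n) (f : CSOmega n t → ℝ)
    (hf : ∀ ω, f (csFlip j ω) = - f ω) : ∑ ω, f ω = 0 := by
  have h := Equiv.sum_comp (csFlip_inv (t := t) j).toPerm f
  simp only [Function.Involutive.coe_toPerm, hf, Finset.sum_neg_distrib] at h
  linarith

lemma csQ_cross {n t : ℕ} (k l k' l' : Fin n) (h1 : ¬ (k = k' ∧ l = l'))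
    (h2 : ¬ (k = l' ∧ l = k')) : ∑ ω : CSOmega n t, csQ ω k l * csQ ω k' l' = 0 := by
  by_cases hkl : k = l
  · simp [csQ, hkl]
  by_cases hkl' : k' = l'
  · simp [csQ, hkl']
  by_cases hk : k' ≠ k ∧ l' ≠ k
  · apply sum_zero_of_flip k
    intro ω
    rw [csQ_flip_left, csQ_flip_ne _ _ _ _ hk.1 hk.2]; ring
  · have hl : k' ≠ l ∧ l' ≠ l := by
      constructor <;> rintro rfl <;> grind
    apply sum_zero_of_flip l
    intro ω
    rw [csQ_comm, csQ_flip_left, csQ_flip_ne _ _ _ _ hl.1 hl.2, csQ_comm]; ring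

lemma csQ_sq_sum {n t : ℕ} (k l : Fin n) :
    (t : ℝ) * ∑ ω : CSOmega n t, csQ ω k l * csQ ω k l ≤ Fintype.card (CSOmega n t) := by
  by_cases hkl : k = l
  · simp [csQ, hkl]
  rcases Nat.eq_zero_or_pos t with rfl | ht
  · simp
  have : NeZero t := ⟨ht.ne'⟩
  have e1 : ∀ ω : CSOmega n t, csQ ω k l * csQ ω k l = if ω.1 k = ω.1 l then 1 else 0 := by
    intro ω
    have a := csSgn_sq ω k
    have b := csSgn_sq ω l
    unfold csQ
    rw [if_neg hkl]
    split_ifs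
    · linear_combination (csSgn ω l * csSgn ω l) * a + b
    · simp
  simp only [e1]
  have e2 : ∀ c : Fin t, ∑ ω : CSOmega n t, (if ω.1 k = ω.1 l then (1:ℝ) else 0)
      = ∑ ω : CSOmega n t, (if c = ω.1 l - ω.1 k then (1:ℝ) else 0) := by
    intro c
    rw [← Equiv.sum_comp (Equiv.prodCongr (Equiv.addRight (fun j => if j = k then c else 0 : Fin n → Fin t))
      (Equiv.refl (Fin n → Bool)))]
    refine Finset.sum_congr rfl fun ω _ => ?_
    simp [Ne.symm hkl, eq_sub_iff_add_eq, add_comm]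
  have e3 : (t : ℝ) * ∑ ω : CSOmega n t, (if ω.1 k = ω.1 l then (1:ℝ) else 0)
      = ∑ c : Fin t, ∑ ω : CSOmega n t, (if c = ω.1 l - ω.1 k then (1:ℝ) else 0) := by
    rw [← Finset.sum_congr rfl (fun c _ => e2 c)]
    simp
  rw [e3, Finset.sum_comm]
  simp

lemma csQ_second {n t : ℕ} (x : Fin n → Fin n → ℝ) :
    (t : ℝ) * ∑ ω : CSOmega n t, (∑ k, ∑ l, csQ ω k l * x k l) ^ 2
      ≤ 2 * Fintype.card (CSOmega n t) * ∑ k, ∑ l, x k l ^ 2 := by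
  set N : ℝ := (Fintype.card (CSOmega n t) : ℝ)
  set A : Fin n → Fin n → ℝ := fun k l => ∑ ω : CSOmega n t, csQ ω k l * csQ ω k l with hA
  have hA0 : ∀ k l, 0 ≤ A k l := fun k l => Finset.sum_nonneg fun ω _ => mul_self_nonneg _
  have hx : ∀ ω : CSOmega n t, (∑ k, ∑ l, csQ ω k l * x k l) ^ 2
      = ∑ k, ∑ l, ∑ k', ∑ l', (csQ ω k l * csQ ω k' l') * (x k l * x k' l') := by
    intro ω
    rw [sq, Finset.sum_mul]
    refine Finset.sum_congr rfl fun k _ => ?_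
    rw [Finset.sum_mul]
    refine Finset.sum_congr rfl fun l _ => ?_
    rw [Finset.mul_sum]
    refine Finset.sum_congr rfl fun k' _ => ?_
    rw [Finset.mul_sum]
    refine Finset.sum_congr rfl fun l' _ => ?_
    ring
  have hsum : ∑ ω : CSOmega n t, (∑ k, ∑ l, csQ ω k l * x k l) ^ 2
      = ∑ k, ∑ l, ∑ k', ∑ l',
        (∑ ω : CSOmega n t, csQ ω k l * csQ ω k' l') * (x k l * x k' l') := by
    simp only [hx, Finset.sum_mul]
    rw [Finset.sum_comm]
    refine Finset.sum_congr rfl fun k _ => ?_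
    rw [Finset.sum_comm]
    refine Finset.sum_congr rfl fun l _ => ?_
    rw [Finset.sum_comm]
    refine Finset.sum_congr rfl fun k' _ => ?_
    rw [Finset.sum_comm]
  have hterm : ∀ k l k' l', (∑ ω : CSOmega n t, csQ ω k l * csQ ω k' l') * (x k l * x k' l')
      ≤ (if k = k' then if l = l' then A k l * x k l ^ 2 else 0 else 0)
        + (if l = k' then if k = l' then A k l * ((x k l ^ 2 + x l k ^ 2) / 2) else 0 else 0) := by
    intro k l k' l'
    have p1 := mul_nonneg (hA0 k l) (sq_nonneg (x k l))
    have p2 : 0 ≤ A k l * ((x k l ^ 2 + x l k ^ 2) / 2) := mul_nonneg (hA0 k l) (by positivity)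
    have p3 : 0 ≤ (if k = k' then if l = l' then A k l * x k l ^ 2 else 0 else 0) := by
      split_ifs <;> first | exact p1 | exact le_rfl
    have p4 : 0 ≤ (if l = k' then if k = l' then A k l * ((x k l ^ 2 + x l k ^ 2) / 2)
        else 0 else 0) := by
      split_ifs <;> first | exact p2 | exact le_rfl
    by_cases h1 : k = k' ∧ l = l'
    · obtain ⟨rfl, rfl⟩ := h1
      refine le_trans (le_of_eq ?_) (le_add_of_nonneg_right p4)
      simp only [if_true, hA]; ring
    by_cases h2 : k = l' ∧ l = k'
    · obtain ⟨rfl, rfl⟩ := h2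
      refine le_trans ?_ (le_add_of_nonneg_left p3)
      simp only [if_true]
      have : ∑ ω : CSOmega n t, csQ ω k l * csQ ω l k = A k l := by
        refine Finset.sum_congr rfl fun ω _ => ?_
        rw [csQ_comm ω l k]
      rw [this]
      refine mul_le_mul_of_nonneg_left ?_ (hA0 k l)
      nlinarith [sq_nonneg (x k l - x l k)]
    rw [csQ_cross k l k' l' h1 h2, zero_mul]
    exact add_nonneg p3 p4
  have hb : ∑ ω : CSOmega n t, (∑ k, ∑ l, csQ ω k l * x k l) ^ 2
      ≤ ∑ k, ∑ l, (A k l * x k l ^ 2 + A k l * ((x k l ^ 2 + x l k ^ 2) / 2)) := by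
    rw [hsum]
    refine Finset.sum_le_sum fun k _ => Finset.sum_le_sum fun l _ => ?_
    refine (Finset.sum_le_sum fun k' _ => Finset.sum_le_sum fun l' _ => hterm k l k' l').trans ?_
    apply le_of_eq
    simp [Finset.sum_add_distrib]
  have hAN : ∀ k l, (t : ℝ) * A k l ≤ N := fun k l => csQ_sq_sum k l
  calc (t : ℝ) * ∑ ω : CSOmega n t, (∑ k, ∑ l, csQ ω k l * x k l) ^ 2
      ≤ t * ∑ k, ∑ l, (A k l * x k l ^ 2 + A k l * ((x k l ^ 2 + x l k ^ 2) / 2)) :=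
        mul_le_mul_of_nonneg_left hb (Nat.cast_nonneg t)
    _ = ∑ k, ∑ l, (t * A k l) * (x k l ^ 2 + (x k l ^ 2 + x l k ^ 2) / 2) := by
        simp only [Finset.mul_sum]
        refine Finset.sum_congr rfl fun k _ => Finset.sum_congr rfl fun l _ => ?_
        ring
    _ ≤ ∑ k, ∑ l, N * (x k l ^ 2 + (x k l ^ 2 + x l k ^ 2) / 2) := by
        refine Finset.sum_le_sum fun k _ => Finset.sum_le_sum fun l _ => ?_
        exact mul_le_mul_of_nonneg_right (hAN k l) (by positivity)
    _ = 2 * N * ∑ k, ∑ l, x k l ^ 2 := by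
        have hc : ∑ k, ∑ l, x l k ^ 2 = ∑ k, ∑ l, x k l ^ 2 := Finset.sum_comm
        simp only [← Finset.mul_sum, Finset.sum_add_distrib, ← Finset.sum_div]
        rw [hc]; ring

/-- error matrix -/
noncomputable def csD {n m t : ℕ} (W : Matrix (Fin n) (Fin m) ℝ) (ω : CSOmega n t)
    (a b : Fin m) : ℝ := ∑ k, ∑ l, csQ ω k l * (W k a * W l b)

lemma cs_second {n m t : ℕ} (W : Matrix (Fin n) (Fin m) ℝ) :
    (t : ℝ) * ∑ ω : CSOmega n t, ∑ a, ∑ b, csD W ω a b ^ 2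
      ≤ 2 * Fintype.card (CSOmega n t) * frobSq W ^ 2 := by
  have e1 : (t : ℝ) * ∑ ω : CSOmega n t, ∑ a, ∑ b, csD W ω a b ^ 2
      = ∑ a, ∑ b, (t : ℝ) * ∑ ω : CSOmega n t, csD W ω a b ^ 2 := by
    simp only [← Finset.mul_sum]
    congr 1
    rw [Finset.sum_comm]
    refine Finset.sum_congr rfl fun a _ => ?_
    rw [Finset.sum_comm]
  rw [e1]
  refine (Finset.sum_le_sum fun a _ => Finset.sum_le_sum fun b _ =>
    csQ_second (t := t) (fun k l => W k a * W l b)).trans (le_of_eq ?_)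
  simp only [← Finset.mul_sum]
  congr 1
  have hF : frobSq W = ∑ j, ∑ i, W i j ^ 2 := Finset.sum_comm
  rw [hF, sq, Finset.sum_mul_sum]
  refine Finset.sum_congr rfl fun a _ => Finset.sum_congr rfl fun b _ => ?_
  rw [Finset.sum_mul_sum]
  simp only [mul_pow]

lemma cs_quad {n t : ℕ} (ω : CSOmega n t) (y : Fin n → ℝ) :
    sqNorm ((csSketch ω).mulVec y) - sqNorm y = ∑ k, ∑ l, csQ ω k l * (y k * y l) := by
  have e1 : sqNorm ((csSketch ω).mulVec y)
      = ∑ k, ∑ l, (csSgn ω k * csSgn ω l * (if ω.1 k = ω.1 l then 1 else 0)) * (y k * y l) := by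
    unfold sqNorm
    simp only [Matrix.mulVec, dotProduct, sq, Finset.sum_mul_sum]
    rw [Finset.sum_comm]
    refine Finset.sum_congr rfl fun k _ => ?_
    rw [Finset.sum_comm]
    refine Finset.sum_congr rfl fun l _ => ?_
    rw [Finset.sum_eq_single (ω.1 k)]
    · simp only [csSketch, csSgn, if_true, eq_comm (a := ω.1 l)]; ring
    · intro b _ hb
      simp [csSketch, Ne.symm hb]
    · simp
  have e2 : sqNorm y = ∑ k, ∑ l, if k = l then y k * y l else 0 := by
    simp [sqNorm, sq]
  rw [e1, e2]
  simp only [← Finset.sum_sub_distrib]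
  refine Finset.sum_congr rfl fun k _ => Finset.sum_congr rfl fun l _ => ?_
  unfold csQ
  split_ifs with h1 h2 h3
  · subst h2
    linear_combination (y k * y k) * csSgn_sq ω k
  · ring
  · subst h3; exact absurd rfl h1
  · ring

lemma cs_det {n m t : ℕ} (W : Matrix (Fin n) (Fin m) ℝ) (ω : CSOmega n t) (θ : Fin m → ℝ) :
    (sqNorm ((csSketch ω * W).mulVec θ) - sqNorm (W.mulVec θ)) ^ 2
      ≤ (∑ a, ∑ b, csD W ω a b ^ 2) * sqNorm θ ^ 2 := by
  rw [← Matrix.mulVec_mulVec, cs_quad]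
  have e : ∑ k, ∑ l, csQ ω k l * (W.mulVec θ k * W.mulVec θ l)
      = ∑ p : Fin m × Fin m, csD W ω p.1 p.2 * (θ p.1 * θ p.2) := by
    rw [Fintype.sum_prod_type]
    have s0 : ∀ k l, csQ ω k l * (W.mulVec θ k * W.mulVec θ l)
        = ∑ a, ∑ b, csQ ω k l * (W k a * θ a * (W l b * θ b)) := by
      intro k l
      simp only [Matrix.mulVec, dotProduct]
      rw [Finset.sum_mul_sum]
      simp only [Finset.mul_sum]
    simp only [s0, csD, Finset.sum_mul]
    have s1 : ∀ k : Fin n, ∑ l, ∑ a, ∑ b, csQ ω k l * (W k a * θ a * (W l b * θ b))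
        = ∑ a, ∑ b, ∑ l, csQ ω k l * (W k a * θ a * (W l b * θ b)) := by
      intro k
      rw [Finset.sum_comm]
      refine Finset.sum_congr rfl fun a _ => Finset.sum_comm
    simp only [s1]
    rw [Finset.sum_comm]
    refine Finset.sum_congr rfl fun a _ => ?_
    rw [Finset.sum_comm]
    refine Finset.sum_congr rfl fun b _ => Finset.sum_congr rfl fun k _ =>
      Finset.sum_congr rfl fun l _ => ?_
    ring
  rw [e]
  refine (Finset.sum_mul_sq_le_sq_mul_sq _ _ _).trans (le_of_eq ?_)
  rw [Fintype.sum_prod_type, Fintype.sum_prod_type]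
  congr 1
  rw [sqNorm, sq (∑ i, θ i ^ 2), Finset.sum_mul_sum]
  simp only [mul_pow]

theorem countSketch_general_guarantee :
    ∃ C : ℝ, 0 < C ∧
      ∀ (n m k : ℕ) (W : Matrix (Fin n) (Fin m) ℝ) (ε δ : ℝ),
        0 < k → 0 < ε → 0 < δ →
        1 - δ ≤ unifPr (fun ω : CSOmega n ⌈C * (k : ℝ) ^ 2 / (ε ^ 2 * δ)⌉₊ =>
          ∀ θ : Fin m → ℝ,
            |sqNorm ((csSketch ω * W).mulVec θ) - sqNorm (W.mulVec θ)|
              ≤ ε * sqNorm θ * (specNorm W ^ 2 + frobSq W / (k : ℝ))) := by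
  classical
  refine ⟨2, by norm_num, ?_⟩
  intro n m k W ε δ hk hε hδ
  have hk' : (0:ℝ) < k := Nat.cast_pos.mpr hk
  have htpos : 0 < ⌈2 * (k : ℝ) ^ 2 / (ε ^ 2 * δ)⌉₊ := Nat.ceil_pos.mpr (by positivity)
  have htle : 2 * (k : ℝ) ^ 2 / (ε ^ 2 * δ) ≤ (⌈2 * (k : ℝ) ^ 2 / (ε ^ 2 * δ)⌉₊ : ℝ) :=
    Nat.le_ceil _
  generalize ⌈2 * (k : ℝ) ^ 2 / (ε ^ 2 * δ)⌉₊ = t at htpos htle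
  have : NeZero t := ⟨htpos.ne'⟩
  have ht : (0:ℝ) < t := Nat.cast_pos.mpr htpos
  have hN : (0:ℝ) < Fintype.card (CSOmega n t) := Nat.cast_pos.mpr Fintype.card_pos
  have hF0 : 0 ≤ frobSq W := Finset.sum_nonneg fun i _ => Finset.sum_nonneg fun j _ => sq_nonneg _
  have hgood : ∀ ω : CSOmega n t,
      ∑ a, ∑ b, csD W ω a b ^ 2 ≤ (ε * (frobSq W / k)) ^ 2 → ∀ θ : Fin m → ℝ,
            |sqNorm ((csSketch ω * W).mulVec θ) - sqNorm (W.mulVec θ)|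
              ≤ ε * sqNorm θ * (specNorm W ^ 2 + frobSq W / (k : ℝ)) := by
    intro ω hω θ
    have hθ : 0 ≤ sqNorm θ := Finset.sum_nonneg fun i _ => sq_nonneg _
    have h1 : |sqNorm ((csSketch ω * W).mulVec θ) - sqNorm (W.mulVec θ)|
        ≤ ε * sqNorm θ * (frobSq W / k) := by
      apply abs_le_of_sq_le_sq _ (by positivity)
      refine (cs_det W ω θ).trans
        ((mul_le_mul_of_nonneg_right hω (sq_nonneg _)).trans (le_of_eq ?_))
      ring
    refine h1.trans (mul_le_mul_of_nonneg_left ?_ (by positivity))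
    linarith [sq_nonneg (specNorm W)]
  unfold unifPr
  rw [le_div_iff₀ hN]
  set P : CSOmega n t → Prop := fun ω => ∀ θ : Fin m → ℝ,
            |sqNorm ((csSketch ω * W).mulVec θ) - sqNorm (W.mulVec θ)|
              ≤ ε * sqNorm θ * (specNorm W ^ 2 + frobSq W / (k : ℝ)) with hP
  have hsplit : ((Finset.univ.filter P).card : ℝ)
      + ((Finset.univ.filter fun ω => ¬ P ω).card : ℝ) = Fintype.card (CSOmega n t) := by
    have := Finset.card_filter_add_card_filter_not (s := (Finset.univ : Finset (CSOmega n t))) P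
    rw [Finset.card_univ] at this
    exact_mod_cast this
  have hsec := cs_second (t := t) W
  have hnn : ∀ ω : CSOmega n t, 0 ≤ ∑ a, ∑ b, csD W ω a b ^ 2 := fun ω =>
    Finset.sum_nonneg fun i _ => Finset.sum_nonneg fun j _ => sq_nonneg _
  have hmarkov : ((Finset.univ.filter fun ω => ¬ P ω).card : ℝ) * (ε * (frobSq W / k)) ^ 2
      ≤ ∑ ω : CSOmega n t, ∑ a, ∑ b, csD W ω a b ^ 2 := by
    calc ((Finset.univ.filter fun ω => ¬ P ω).card : ℝ) * (ε * (frobSq W / k)) ^ 2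
        = ∑ ω ∈ Finset.univ.filter fun ω => ¬ P ω, (ε * (frobSq W / k)) ^ 2 := by simp
      _ ≤ ∑ ω ∈ Finset.univ.filter fun ω => ¬ P ω, ∑ a, ∑ b, csD W ω a b ^ 2 := by
          refine Finset.sum_le_sum fun ω hω => ?_
          by_contra hcon
          exact (Finset.mem_filter.mp hω).2 (hgood ω (not_le.mp hcon).le)
      _ ≤ _ := Finset.sum_le_sum_of_subset_of_nonneg (Finset.filter_subset _ _)
          fun ω _ _ => hnn ω
  have hbad : ((Finset.univ.filter fun ω => ¬ P ω).card : ℝ) ≤ δ * Fintype.card (CSOmega n t) := by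
    rcases hF0.eq_or_lt with hF | hF
    · have hall : ∀ ω, P ω := by
        intro ω
        apply hgood
        rw [← hF] at hsec
        have h0 : ∑ ω : CSOmega n t, ∑ a, ∑ b, csD W ω a b ^ 2 ≤ 0 := by
          by_contra hcon
          have := mul_pos ht (not_le.mp hcon)
          norm_num at hsec
          linarith
        have := Finset.single_le_sum (fun ω _ => hnn ω) (Finset.mem_univ ω)
        exact this.trans (h0.trans (sq_nonneg _))
      simp only [hall, not_true_eq_false, Finset.filter_false, Finset.card_empty, Nat.cast_zero]
      positivity
    · have h1 := (mul_le_mul_of_nonneg_left hmarkov ht.le).trans hsec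
      rw [div_le_iff₀ (by positivity)] at htle
      generalize ((Finset.univ.filter fun ω => ¬ P ω).card : ℝ) = B at *
      generalize (Fintype.card (CSOmega n t) : ℝ) = N at *
      have h2 : (t * ε ^ 2 * B) * (frobSq W ^ 2 / k ^ 2)
          ≤ (2 * k ^ 2 * N) * (frobSq W ^ 2 / k ^ 2) := by
        calc _ = t * (B * (ε * (frobSq W / k)) ^ 2) := by ring
          _ ≤ _ := h1
          _ = _ := by field_simp
      have h3 := le_of_mul_le_mul_right h2 (by positivity)
      have h4 : (t * ε ^ 2) * B ≤ (t * ε ^ 2) * (δ * N) := by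
        nlinarith [mul_le_mul_of_nonneg_right htle hN.le]
      exact le_of_mul_le_mul_left h4 (by positivity)
  have : (1 - δ) * (Fintype.card (CSOmega n t) : ℝ) ≤ ((Finset.univ.filter P).card : ℝ) := by
    linarith
  convert this
end

section
/- Let W₁, …, W_τ ∈ ℝ^{n×m} be a sequence of matrices, α₁, …, α_τ ≥ 0 a sequence of nonnegative weights, and S₁, …, S_τ ∈ ℝ^{t×n} a sequence of mutually independent CountSketch matrices of sketch size t. There exists an absolute constant C > 0 such that for any fixed vector θ ∈ ℝ^m, with probability at least 0.99 (over the randomness of S₁,…,S_τ), | ‖(Σ_{i=1}^τ √α_i · S_i·W_i)·θ‖₂² − Σ_{i=1}^τ α_i·‖W_i·θ‖₂² | ≤ (C/√t) · Σ_{i=1}^τ α_i·‖W_i·θ‖₂². -/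
open Finset Matrix

/-- sign -/
noncomputable def auxSg (b : Bool) : ℝ := if b then (1 : ℝ) else -1

/-- aggregated sketch -/
noncomputable def auxY {t N : ℕ} (x : Fin N → ℝ) (ω : Fin N → Fin t × Bool) (r : Fin t) : ℝ :=
  ∑ p, (auxSg (ω p).2 * (if (ω p).1 = r then 1 else 0)) * x p

lemma auxY_cons {t N : ℕ} (x : Fin (N+1) → ℝ) (a : Fin t × Bool) (ω : Fin N → Fin t × Bool) :
    ∑ r, (auxY x (Fin.cons a ω : Fin (N+1) → Fin t × Bool) r)^2
      = x 0 ^ 2 + 2 * x 0 * auxSg a.2 * auxY (fun p => x p.succ) ω a.1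
        + ∑ r, (auxY (fun p => x p.succ) ω r)^2 := by
  have hs : auxSg a.2 ^ 2 = 1 := by unfold auxSg; split_ifs <;> norm_num
  have h : ∀ r, (auxY x (Fin.cons a ω : Fin (N+1) → Fin t × Bool) r)^2
      = (if a.1 = r then x 0 ^ 2 + 2 * x 0 * auxSg a.2 * auxY (fun p => x p.succ) ω r else 0)
        + (auxY (fun p => x p.succ) ω r)^2 := by
    intro r
    have : auxY x (Fin.cons a ω : Fin (N+1) → Fin t × Bool) r
      = (auxSg a.2 * (if a.1 = r then 1 else 0)) * x 0 + auxY (fun p => x p.succ) ω r := by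
      simp [auxY, Fin.sum_univ_succ]
    rw [this]
    split_ifs
    · linear_combination (x 0 ^ 2) * hs
    · ring
  rw [Finset.sum_congr rfl (fun r _ => h r), Finset.sum_add_distrib, Finset.sum_ite_eq]
  simp

lemma aux_sum_cons {β : Type*} [Fintype β] {N : ℕ} (F : (Fin (N+1) → β) → ℝ) :
    ∑ ω, F ω = ∑ ω : Fin N → β, ∑ a : β, F (Fin.cons a ω : Fin (N+1) → β) := by
  rw [← Equiv.sum_comp (Fin.consEquiv (fun _ : Fin (N+1) => β)) F, Fintype.sum_prod_type,
    Finset.sum_comm]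
  rfl

lemma aux_mean {t : ℕ} : ∀ {N : ℕ} (x : Fin N → ℝ),
    ∑ ω : Fin N → Fin t × Bool, ∑ r, (auxY x ω r)^2 = (2 * t : ℝ)^N * ∑ p, x p ^ 2
  | 0, x => by simp [auxY]
  | N+1, x => by
    rw [aux_sum_cons]
    have : ∀ ω : Fin N → Fin t × Bool,
        ∑ a : Fin t × Bool, ∑ r, (auxY x (Fin.cons a ω : Fin (N+1) → Fin t × Bool) r)^2
        = 2 * t * (x 0 ^ 2 + ∑ r, (auxY (fun p => x p.succ) ω r)^2) := by
      intro ω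
      simp only [auxY_cons, Fintype.sum_prod_type, Fintype.sum_bool, auxSg]
      rw [Finset.sum_congr rfl (g := fun _ => 2 * (x 0 ^ 2 + ∑ r, (auxY (fun p => x p.succ) ω r)^2))]
      · simp; ring
      · intro i _; simp; ring
    rw [Finset.sum_congr rfl (fun ω _ => this ω), ← Finset.mul_sum, Finset.sum_add_distrib,
      aux_mean, Fin.sum_univ_succ]
    simp
    ring

lemma aux_var {t : ℕ} (ht : 0 < t) : ∀ {N : ℕ} (x : Fin N → ℝ),
    ∑ ω : Fin N → Fin t × Bool, (∑ r, (auxY x ω r)^2 - ∑ p, x p ^ 2)^2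
      ≤ (2 * t : ℝ)^N * (2 / t) * (∑ p, x p ^ 2)^2
  | 0, x => by simp [auxY]
  | N+1, x => by
    have ht' : (0 : ℝ) < t := by exact_mod_cast ht
    rw [aux_sum_cons]
    have : ∀ ω : Fin N → Fin t × Bool,
        ∑ a : Fin t × Bool,
          (∑ r, (auxY x (Fin.cons a ω : Fin (N+1) → Fin t × Bool) r)^2 - ∑ p, x p ^ 2)^2
        = 2 * t * (∑ r, (auxY (fun p => x p.succ) ω r)^2 - ∑ p : Fin N, x p.succ ^ 2)^2
          + 8 * x 0 ^ 2 * ∑ r, (auxY (fun p => x p.succ) ω r)^2 := by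
      intro ω
      simp only [auxY_cons, Fintype.sum_prod_type, Fintype.sum_bool, auxSg, Fin.sum_univ_succ]
      rw [Finset.sum_congr rfl (g := fun i =>
        2 * (∑ r, (auxY (fun p => x p.succ) ω r)^2 - ∑ p : Fin N, x p.succ ^ 2)^2
          + 8 * x 0 ^ 2 * (auxY (fun p => x p.succ) ω i)^2)]
      · rw [Finset.sum_add_distrib, Finset.sum_const, ← Finset.mul_sum]; simp; ring
      · intro i _; simp; ring
    rw [Finset.sum_congr rfl (fun ω _ => this ω), Finset.sum_add_distrib, ← Finset.mul_sum,
      ← Finset.mul_sum, aux_mean, Fin.sum_univ_succ]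
    have ih := aux_var ht (fun p : Fin N => x p.succ)
    generalize ∑ p : Fin N, x p.succ ^ 2 = A at *
    have hp : (0 : ℝ) < (2 * t : ℝ)^N := by positivity
    have h1 := mul_le_mul_of_nonneg_left ih (by positivity : (0 : ℝ) ≤ 2 * t)
    refine (add_le_add_left h1 _).trans ?_
    have h2 : (2 * t : ℝ)^(N+1) * (2 / t) * (x 0 ^ 2 + A)^2
      = (2 * t * ((2 * t : ℝ)^N * (2 / t) * A^2) + 8 * x 0 ^ 2 * ((2 * t : ℝ)^N * A))
        + 4 * (2 * t : ℝ)^N * (x 0 ^ 2)^2 := by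
      rw [pow_succ]; field_simp; ring
    rw [h2]
    have : 0 ≤ 4 * (2 * t : ℝ)^N * (x 0 ^ 2)^2 := by positivity
    linarith

lemma aux_cheb {Ω : Type*} [Fintype Ω] (D : Ω → ℝ) (A t : ℝ) (ht : 0 < t) (hA : 0 ≤ A)
    (hc : 0 < Fintype.card Ω)
    (h : ∑ ω, D ω ^ 2 ≤ (Fintype.card Ω : ℝ) * (2 / t) * A^2) :
    0.99 ≤ unifPr (fun ω => |D ω| ≤ (15 / Real.sqrt t) * A) := by
  classical
  have hc' : (0 : ℝ) < Fintype.card Ω := by exact_mod_cast hc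
  unfold unifPr
  rw [le_div_iff₀ hc']
  have hsplit := Finset.card_filter_add_card_filter_not (s := (Finset.univ : Finset Ω))
    (fun ω => |D ω| ≤ (15 / Real.sqrt t) * A)
  rw [Finset.card_univ] at hsplit
  have hs' : ((Finset.univ.filter (fun ω => |D ω| ≤ (15 / Real.sqrt t) * A)).card : ℝ)
    + ((Finset.univ.filter (fun ω => ¬ |D ω| ≤ (15 / Real.sqrt t) * A)).card : ℝ)
    = Fintype.card Ω := by exact_mod_cast hsplit
  have key : ((Finset.univ.filter (fun ω => ¬ |D ω| ≤ (15 / Real.sqrt t) * A)).card : ℝ)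
      ≤ 0.01 * Fintype.card Ω := by
    rcases hA.eq_or_lt with h0 | hpos
    · subst h0
      have hz : ∑ ω, D ω ^ 2 = 0 :=
        le_antisymm (by simpa using h) (Finset.sum_nonneg fun _ _ => sq_nonneg _)
      rw [Finset.sum_eq_zero_iff_of_nonneg (fun _ _ => sq_nonneg _)] at hz
      have : Finset.univ.filter (fun ω => ¬ |D ω| ≤ (15 / Real.sqrt t) * 0) = ∅ := by
        apply Finset.filter_eq_empty_iff.2
        intro ω hω
        have := pow_eq_zero_iff (two_ne_zero) |>.1 (hz ω hω)
        simp [this]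
      rw [this]; simp only [Finset.card_empty, Nat.cast_zero]; positivity
    · have h1 : ((Finset.univ.filter (fun ω => ¬ |D ω| ≤ (15 / Real.sqrt t) * A)).card : ℝ)
          * (225 / t * A^2) ≤ ∑ ω, D ω ^ 2 := by
        rw [← nsmul_eq_mul, ← Finset.sum_const]
        refine (Finset.sum_le_sum ?_).trans
          (Finset.sum_le_sum_of_subset_of_nonneg (Finset.filter_subset _ _)
            (fun _ _ _ => sq_nonneg _))
        intro ω hω
        have hω := not_le.1 (Finset.mem_filter.1 hω).2
        have h2 := pow_le_pow_left₀ (by positivity) hω.le 2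
        rw [sq_abs, mul_pow, div_pow, Real.sq_sqrt ht.le] at h2
        norm_num at h2
        exact h2
      have h3 := h1.trans h
      have hq : 0 < A^2 / t := by positivity
      have h4 : ((Finset.univ.filter (fun ω => ¬ |D ω| ≤ (15 / Real.sqrt t) * A)).card : ℝ) * 225
          ≤ Fintype.card Ω * 2 := by
        refine le_of_mul_le_mul_right ?_ hq
        calc _ = _ := by ring
          _ ≤ _ := h3
          _ = _ := by ring
      linarith
  linarith

/-- reindexing of the sample space -/
def auxEquiv (n t τ : ℕ) : (Fin τ → CSOmega n t) ≃ (Fin (τ * n) → Fin t × Bool) where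
  toFun ω p := ((ω (finProdFinEquiv.symm p).1).1 (finProdFinEquiv.symm p).2,
    (ω (finProdFinEquiv.symm p).1).2 (finProdFinEquiv.symm p).2)
  invFun f i := (fun k => (f (finProdFinEquiv (i, k))).1, fun k => (f (finProdFinEquiv (i, k))).2)
  left_inv ω := by
    funext i
    ext k <;> simp only [Equiv.symm_apply_apply]
  right_inv f := by
    funext p
    simp only [Prod.mk.eta, Equiv.apply_symm_apply]

/-- **Theorem (online aggregation of sketches).**
For matrices `W₁,…,W_τ ∈ ℝ^{n×m}`, nonnegative weights `α₁,…,α_τ`, and mutually independent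
CountSketch matrices `S₁,…,S_τ ∈ ℝ^{t×n}`, there is an absolute constant `C > 0` such that
for any fixed `θ ∈ ℝ^m`, with probability at least `0.99`,
`|‖(Σᵢ √αᵢ SᵢWᵢ)θ‖₂² − Σᵢ αᵢ‖Wᵢθ‖₂²| ≤ (C/√t)·Σᵢ αᵢ‖Wᵢθ‖₂²`. -/
theorem countSketch_online_aggregation :
    ∃ C : ℝ, 0 < C ∧
      ∀ (n m t τ : ℕ), 0 < t →
        ∀ (W : Fin τ → Matrix (Fin n) (Fin m) ℝ) (α : Fin τ → ℝ), (∀ i, 0 ≤ α i) →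
        ∀ θ : Fin m → ℝ,
          0.99 ≤ unifPr (fun ω : Fin τ → CSOmega n t =>
            |sqNorm ((∑ i, Real.sqrt (α i) • (csSketch (ω i) * W i)).mulVec θ)
                - ∑ i, α i * sqNorm ((W i).mulVec θ)|
              ≤ (C / Real.sqrt t) * ∑ i, α i * sqNorm ((W i).mulVec θ)) := by
  refine ⟨15, by norm_num, ?_⟩
  intro n m t τ ht W α hα θ
  have ht' : (0 : ℝ) < t := by exact_mod_cast ht
  let x : Fin (τ * n) → ℝ := fun p =>
    Real.sqrt (α (finProdFinEquiv.symm p).1)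
      * (W (finProdFinEquiv.symm p).1).mulVec θ (finProdFinEquiv.symm p).2
  have hx : ∑ p, x p ^ 2 = ∑ i, α i * sqNorm ((W i).mulVec θ) := by
    rw [← Equiv.sum_comp finProdFinEquiv, Fintype.sum_prod_type]
    refine Finset.sum_congr rfl fun i _ => ?_
    rw [sqNorm, Finset.mul_sum]
    refine Finset.sum_congr rfl fun k _ => ?_
    simp only [x, Equiv.symm_apply_apply]
    rw [mul_pow, Real.sq_sqrt (hα i)]
  have hy : ∀ ω : Fin τ → CSOmega n t,
      sqNorm ((∑ i, Real.sqrt (α i) • (csSketch (ω i) * W i)).mulVec θ)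
        = ∑ r, (auxY x (auxEquiv n t τ ω) r)^2 := by
    intro ω
    unfold sqNorm
    refine Finset.sum_congr rfl fun r _ => ?_
    congr 1
    rw [Matrix.sum_mulVec, Finset.sum_apply, auxY, ← Equiv.sum_comp finProdFinEquiv,
      Fintype.sum_prod_type]
    refine Finset.sum_congr rfl fun i _ => ?_
    rw [Matrix.smul_mulVec, ← Matrix.mulVec_mulVec, Pi.smul_apply, smul_eq_mul]
    conv_lhs => rw [Matrix.mulVec, dotProduct, Finset.mul_sum]
    refine Finset.sum_congr rfl fun k _ => ?_
    simp only [x, auxEquiv, Equiv.coe_fn_mk, Equiv.symm_apply_apply, csSketch, auxSg]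
    ring
  have hcard : (Fintype.card (Fin τ → CSOmega n t) : ℝ) = (2 * t : ℝ)^(τ * n) := by
    rw [Fintype.card_congr (auxEquiv n t τ)]
    simp [mul_comm]
  refine aux_cheb _ _ (t : ℝ) ht' ?_ ?_ ?_
  · rw [← hx]; exact Finset.sum_nonneg fun _ _ => sq_nonneg _
  · have : (0 : ℝ) < Fintype.card (Fin τ → CSOmega n t) := by rw [hcard]; positivity
    exact_mod_cast this
  · rw [hcard, ← hx]
    simp only [hy]
    rw [Equiv.sum_comp (auxEquiv n t τ)
      (fun ω => (∑ r, (auxY x ω r)^2 - ∑ p, x p ^ 2)^2)]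
    exact aux_var ht x
end

section
/- Let W₁, …, W_τ ∈ ℝ^{n×m} be matrices, α₁, …, α_τ ≥ 0 weights, and S₁, …, S_τ ∈ ℝ^{t×n} mutually independent CountSketch matrices of sketch size t. Define the aggregated sketch W̃_τ = Σ_{i=1}^τ √α_i · S_i·W_i and the aggregated importance matrix Ω̃_τ = Σ_{i=1}^τ α_i · W_iᵀW_i. Then for any fixed θ ∈ ℝ^m, with probability at least 0.99, the sketched quadratic form satisfies ‖W̃_τ·θ‖₂² = (1 ± C/√t)·θᵀ·Ω̃_τ·θ for some absolute constant C > 0; that is, |‖W̃_τ·θ‖₂² − θᵀ·Ω̃_τ·θ| ≤ (C/√t)·θᵀ·Ω̃_τ·θ. -/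
open Finset Matrix

noncomputable def csEps (b : Bool) : ℝ := if b then 1 else -1

lemma csEps_sq (b : Bool) : csEps b * csEps b = 1 := by cases b <;> simp [csEps]

lemma csEps_not (b : Bool) : csEps (!b) = - csEps b := by cases b <;> simp [csEps]

lemma cs_flip {K : Type*} [Fintype K] [DecidableEq K] (x : K) (f : (K → Bool) → ℝ)
    (hf : ∀ s, f (Function.update s x (!s x)) = - f s) : ∑ s, f s = 0 := by
  have hinv : Function.Involutive (fun s : K → Bool => Function.update s x (!s x)) := by
    intro s; simp
  have h := Equiv.sum_comp (Function.Involutive.toPerm _ hinv) f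
  have h2 : ∑ s, f ((Function.Involutive.toPerm _ hinv) s) = - ∑ s, f s := by
    rw [← Finset.sum_neg_distrib]
    exact Finset.sum_congr rfl (fun s _ => hf s)
  linarith

lemma cs_four {K : Type*} [Fintype K] [DecidableEq K] (p q r u : K) (hpq : p ≠ q) (hru : r ≠ u) :
    ∑ s : K → Bool, csEps (s p) * csEps (s q) * (csEps (s r) * csEps (s u)) =
      (Fintype.card (K → Bool) : ℝ) *
        ((if p = r ∧ q = u then 1 else 0) + (if p = u ∧ q = r then 1 else 0)) := by
  by_cases h1 : p = r ∧ q = u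
  · obtain ⟨rfl, rfl⟩ := h1
    have : ∀ s : K → Bool, csEps (s p) * csEps (s q) * (csEps (s p) * csEps (s q)) = 1 := by
      intro s
      have := csEps_sq (s p); have := csEps_sq (s q)
      calc _ = (csEps (s p) * csEps (s p)) * (csEps (s q) * csEps (s q)) := by ring
        _ = 1 := by simp [*]
    simp only [this]
    simp [hpq]
  by_cases h2 : p = u ∧ q = r
  · obtain ⟨rfl, rfl⟩ := h2
    have : ∀ s : K → Bool, csEps (s p) * csEps (s q) * (csEps (s q) * csEps (s p)) = 1 := by
      intro s
      have := csEps_sq (s p); have := csEps_sq (s q)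
      calc _ = (csEps (s p) * csEps (s p)) * (csEps (s q) * csEps (s q)) := by ring
        _ = 1 := by simp [*]
    simp only [this]
    simp [hpq]
  rw [if_neg h1, if_neg h2]
  simp only [add_zero, mul_zero]
  by_cases hp : p = r ∨ p = u
  · have hqr : r ≠ q := by rintro rfl; grind
    have hqu : u ≠ q := by rintro rfl; grind
    apply cs_flip q
    intro s
    simp [Function.update_of_ne, hpq, hqr, hqu, csEps_not]
  · push Not at hp
    apply cs_flip p
    intro s
    simp [Function.update_of_ne, hpq.symm, hp.1.symm, hp.2.symm, csEps_not]

lemma cs_quad_s3 {K : Type*} [Fintype K] [DecidableEq K] (b : K → K → ℝ) (hb : ∀ p, b p p = 0)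
    (hs : ∀ p q, b p q = b q p) :
    ∑ s : K → Bool, (∑ p, ∑ q, csEps (s p) * csEps (s q) * b p q) ^ 2 =
      (Fintype.card (K → Bool) : ℝ) * (2 * ∑ p, ∑ q, b p q ^ 2) := by
  have e1 : ∀ s : K → Bool, (∑ p, ∑ q, csEps (s p) * csEps (s q) * b p q) ^ 2 =
      ∑ x : K × K, ∑ y : K × K, (csEps (s x.1) * csEps (s x.2) * (csEps (s y.1) * csEps (s y.2)))
        * (b x.1 x.2 * b y.1 y.2) := by
    intro s
    rw [← Fintype.sum_prod_type' (fun p q => csEps (s p) * csEps (s q) * b p q), sq,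
      Finset.sum_mul_sum]
    refine Finset.sum_congr rfl fun x _ => Finset.sum_congr rfl fun y _ => ?_
    ring
  simp only [e1]
  rw [Finset.sum_comm]
  have e2 : ∀ x : K × K, ∑ s : K → Bool, ∑ y : K × K,
      (csEps (s x.1) * csEps (s x.2) * (csEps (s y.1) * csEps (s y.2)))
        * (b x.1 x.2 * b y.1 y.2) = (Fintype.card (K → Bool) : ℝ) * (2 * b x.1 x.2 ^ 2) := by
    intro x
    rw [Finset.sum_comm]
    have : ∀ y : K × K, ∑ s : K → Bool,
      (csEps (s x.1) * csEps (s x.2) * (csEps (s y.1) * csEps (s y.2)))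
        * (b x.1 x.2 * b y.1 y.2) = (if y = x then
          (Fintype.card (K → Bool) : ℝ) * (b x.1 x.2 * b y.1 y.2) else 0) +
          (if y = (x.2, x.1) then
          (Fintype.card (K → Bool) : ℝ) * (b x.1 x.2 * b y.1 y.2) else 0) := by
      rintro ⟨r, u⟩
      obtain ⟨p, q⟩ := x
      by_cases hpq : p = q
      · subst hpq; simp [hb]
      by_cases hru : r = u
      · subst hru; simp [hb]
      rw [← Finset.sum_mul, cs_four p q r u hpq hru]
      simp only [Prod.mk.injEq]
      by_cases h1 : p = r ∧ q = u
      · obtain ⟨rfl, rfl⟩ := h1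
        simp [hpq]
      · by_cases h2 : p = u ∧ q = r
        · obtain ⟨rfl, rfl⟩ := h2
          simp [hpq]
        · rw [if_neg h1, if_neg h2, if_neg (by grind), if_neg (by grind)]; simp
    simp only [this]
    rw [Finset.sum_add_distrib]
    simp only [Finset.sum_ite_eq', Finset.mem_univ, if_true]
    rw [hs x.2 x.1]; ring
  simp only [← Fintype.sum_prod_type' (fun p q => b p q ^ 2)]
  rw [Finset.sum_congr rfl (fun x _ => e2 x), ← Finset.mul_sum, ← Finset.mul_sum]

lemma cs_hash {K : Type*} [Fintype K] [DecidableEq K] {t : ℕ} (ht : 0 < t) (p q : K) (hpq : p ≠ q) :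
    (t : ℝ) * ∑ h : K → Fin t, (if h p = h q then (1 : ℝ) else 0) = Fintype.card (K → Fin t) := by
  have : NeZero t := ⟨ht.ne'⟩
  have h1 : ∀ c : Fin t, ∑ h : K → Fin t, (if h p = h q then (1 : ℝ) else 0) =
      ∑ h : K → Fin t, (if c = h q - h p then (1 : ℝ) else 0) := by
    intro c
    rw [← Equiv.sum_comp (Equiv.addRight (Pi.single p c : K → Fin t))]
    refine Finset.sum_congr rfl fun h _ => ?_
    have : h p + c = h q ↔ c = h q - h p := by
      rw [eq_sub_iff_add_eq, add_comm]
    simp [Pi.single_eq_of_ne hpq.symm, this]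
  have h2 : (t : ℝ) * ∑ h : K → Fin t, (if h p = h q then (1 : ℝ) else 0) =
      ∑ c : Fin t, ∑ h : K → Fin t, (if c = h q - h p then (1 : ℝ) else 0) := by
    rw [← Finset.sum_congr rfl (fun c _ => h1 c)]
    simp
  rw [h2, Finset.sum_comm]
  simp

noncomputable def csB {K : Type*} [DecidableEq K] {t : ℕ} (y : K → ℝ) (h : K → Fin t) (p q : K) : ℝ :=
  if p = q then 0 else (if h p = h q then (1 : ℝ) else 0) * (y p * y q)

lemma cs_decomp {K : Type*} [Fintype K] [DecidableEq K] {t : ℕ} (y : K → ℝ)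
    (h : K → Fin t) (s : K → Bool) :
    ∑ j, (∑ p, csEps (s p) * (if h p = j then 1 else 0) * y p) ^ 2 - ∑ p, y p ^ 2 =
      ∑ p, ∑ q, csEps (s p) * csEps (s q) * csB y h p q := by
  have e1 : ∑ j, (∑ p, csEps (s p) * (if h p = j then 1 else 0) * y p) ^ 2 =
      ∑ p, ∑ q, csEps (s p) * csEps (s q) * ((if h p = h q then (1 : ℝ) else 0) * (y p * y q)) := by
    simp only [sq, Finset.sum_mul_sum]
    rw [Finset.sum_comm]
    refine Finset.sum_congr rfl fun p _ => ?_
    rw [Finset.sum_comm]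
    refine Finset.sum_congr rfl fun q _ => ?_
    rw [Finset.sum_eq_single (h p)]
    · by_cases hh : h p = h q
      · simp [hh]; ring
      · simp [hh, Ne.symm hh]
    · intro j _ hj
      simp [hj.symm]
    · simp
  rw [e1, ← Finset.sum_sub_distrib]
  refine Finset.sum_congr rfl fun p _ => ?_
  have : y p ^ 2 = ∑ q, if p = q then y p ^ 2 else 0 := by simp
  rw [this, ← Finset.sum_sub_distrib]
  refine Finset.sum_congr rfl fun q _ => ?_
  unfold csB
  by_cases hpq : p = q
  · subst hpq; simp [csEps_sq]; ring
  · simp [hpq]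

lemma cs_second_s3 {K : Type*} [Fintype K] [DecidableEq K] {t : ℕ} (ht : 0 < t) (y : K → ℝ) :
    (t : ℝ) * ∑ x : (K → Fin t) × (K → Bool),
      (∑ j, (∑ p, csEps (x.2 p) * (if x.1 p = j then 1 else 0) * y p) ^ 2 - ∑ p, y p ^ 2) ^ 2 ≤
    (Fintype.card ((K → Fin t) × (K → Bool)) : ℝ) * (2 * (∑ p, y p ^ 2) ^ 2) := by
  simp only [cs_decomp]
  rw [Fintype.sum_prod_type]
  have hq : ∀ h : K → Fin t, ∑ s : K → Bool,
      (∑ p, ∑ q, csEps (s p) * csEps (s q) * csB y h p q) ^ 2 =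
      (Fintype.card (K → Bool) : ℝ) * (2 * ∑ p, ∑ q, csB y h p q ^ 2) := by
    intro h
    apply cs_quad_s3
    · intro p; simp [csB]
    · intro p q; unfold csB; simp only [eq_comm (a := p), eq_comm (a := h p), mul_comm (y p)]
  simp only [hq]
  rw [← Finset.mul_sum, ← Finset.mul_sum, Fintype.card_prod]
  rw [Nat.cast_mul]
  have key : (t : ℝ) * ∑ h : K → Fin t, ∑ p, ∑ q, csB y h p q ^ 2 ≤
      (Fintype.card (K → Fin t) : ℝ) * (∑ p, y p ^ 2) ^ 2 := by
    rw [Finset.sum_comm, sq (∑ p, y p ^ 2), Finset.sum_mul_sum, Finset.mul_sum, Finset.mul_sum]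
    refine Finset.sum_le_sum fun p _ => ?_
    rw [Finset.sum_comm, Finset.mul_sum, Finset.mul_sum]
    refine Finset.sum_le_sum fun q _ => ?_
    by_cases hpq : p = q
    · simp only [csB, hpq, if_true]
      simp; positivity
    · rw [← cs_hash ht p q hpq, mul_assoc, Finset.sum_mul]
      refine le_of_eq ?_
      congr 1
      refine Finset.sum_congr rfl fun h _ => ?_
      by_cases hh : h p = h q
      · simp [csB, hpq, hh]; ring
      · simp [csB, hpq, hh]
  calc _ = 2 * (Fintype.card (K → Bool) : ℝ) *
        ((t : ℝ) * ∑ h : K → Fin t, ∑ p, ∑ q, csB y h p q ^ 2) := by ring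
    _ ≤ 2 * (Fintype.card (K → Bool) : ℝ) *
        ((Fintype.card (K → Fin t) : ℝ) * (∑ p, y p ^ 2) ^ 2) := by gcongr
    _ = _ := by ring

def csEquiv (n t τ : ℕ) : (Fin τ → CSOmega n t) ≃
    ((Fin τ × Fin n → Fin t) × (Fin τ × Fin n → Bool)) where
  toFun ω := (fun p => (ω p.1).1 p.2, fun p => (ω p.1).2 p.2)
  invFun x := fun i => (fun k => x.1 (i, k), fun k => x.2 (i, k))
  left_inv _ := rfl
  right_inv _ := rfl

lemma cs_cheb {Ω : Type*} [Fintype Ω] [Nonempty Ω] (D : Ω → ℝ) (t Y : ℝ) (ht : 0 < t) (hY : 0 ≤ Y)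
    (h : t * ∑ ω, D ω ^ 2 ≤ (Fintype.card Ω : ℝ) * (2 * Y ^ 2)) :
    0.99 ≤ unifPr (fun ω => |D ω| ≤ (15 / Real.sqrt t) * Y) := by
  classical
  have hN : (0 : ℝ) < Fintype.card Ω := by exact_mod_cast Fintype.card_pos
  unfold unifPr
  rw [le_div_iff₀ hN]
  have hst : 0 < Real.sqrt t := Real.sqrt_pos.mpr ht
  have hsq : Real.sqrt t ^ 2 = t := Real.sq_sqrt ht.le
  rcases hY.eq_or_lt with rfl | hY
  · have h0 : ∑ ω, D ω ^ 2 ≤ 0 := by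
      by_contra hc
      push Not at hc
      have := mul_pos ht hc
      simp at h
      linarith
    have hD : ∀ ω, D ω = 0 := by
      intro ω
      have := Finset.single_le_sum (f := fun ω => D ω ^ 2) (fun i _ => sq_nonneg _) (Finset.mem_univ ω)
      have h2 : D ω ^ 2 = 0 := le_antisymm (this.trans h0) (sq_nonneg _)
      simpa using h2
    simp [hD]
    linarith
  · have hcard := Finset.card_filter_add_card_filter_not (s := (Finset.univ : Finset Ω))
      (fun ω => |D ω| ≤ (15 / Real.sqrt t) * Y)
    rw [Finset.card_univ] at hcard
    set A := Finset.univ.filter (fun ω => ¬ |D ω| ≤ (15 / Real.sqrt t) * Y) with hA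
    have hbad : (A.card : ℝ) * (225 * Y ^ 2) ≤ t * ∑ ω, D ω ^ 2 := by
      calc (A.card : ℝ) * (225 * Y ^ 2) = ∑ ω ∈ A, 225 * Y ^ 2 := by simp
        _ ≤ ∑ ω ∈ A, t * D ω ^ 2 := by
          refine Finset.sum_le_sum fun ω hω => ?_
          have hω := (Finset.mem_filter.mp hω).2
          push Not at hω
          have h3 : ((15 / Real.sqrt t) * Y) ^ 2 ≤ D ω ^ 2 := by
            rw [← sq_abs (D ω)]
            gcongr
          calc 225 * Y ^ 2 = t * ((15 / Real.sqrt t) * Y) ^ 2 := by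
                rw [mul_pow, div_pow, hsq]; field_simp; norm_num
            _ ≤ _ := by gcongr
        _ ≤ ∑ ω, t * D ω ^ 2 :=
          Finset.sum_le_sum_of_subset_of_nonneg (Finset.subset_univ _)
            (fun i _ _ => by positivity)
        _ = _ := by rw [Finset.mul_sum]
    have hA2 : (A.card : ℝ) * 225 ≤ (Fintype.card Ω : ℝ) * 2 := by
      have hY2 : 0 < Y ^ 2 := by positivity
      refine le_of_mul_le_mul_right ?_ hY2
      linarith
    have hc' : ((Finset.univ.filter (fun ω => |D ω| ≤ (15 / Real.sqrt t) * Y)).card : ℝ) +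
      A.card = Fintype.card Ω := by exact_mod_cast hcard
    have h5 : 0.99 * (Fintype.card Ω : ℝ) ≤
      ((Finset.univ.filter (fun ω => |D ω| ≤ (15 / Real.sqrt t) * Y)).card : ℝ) := by
      norm_num; linarith
    convert h5

lemma cs_quadform {n m τ : ℕ} (W : Fin τ → Matrix (Fin n) (Fin m) ℝ) (α : Fin τ → ℝ)
    (hα : ∀ i, 0 ≤ α i) (θ : Fin m → ℝ) :
    θ ⬝ᵥ ((∑ i, α i • ((W i)ᵀ * W i)).mulVec θ) =
      ∑ p : Fin τ × Fin n, (Real.sqrt (α p.1) * (W p.1).mulVec θ p.2) ^ 2 := by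
  rw [Matrix.sum_mulVec, dotProduct_sum, Fintype.sum_prod_type]
  refine Finset.sum_congr rfl fun i _ => ?_
  rw [Matrix.smul_mulVec, dotProduct_smul, ← Matrix.mulVec_mulVec, Matrix.dotProduct_mulVec,
    Matrix.vecMul_transpose]
  simp only [mul_pow, Real.sq_sqrt (hα i), ← Finset.mul_sum, smul_eq_mul, dotProduct]
  simp only [sq]

lemma cs_sketchform {n m t τ : ℕ} (W : Fin τ → Matrix (Fin n) (Fin m) ℝ) (α : Fin τ → ℝ)
    (θ : Fin m → ℝ) (ω : Fin τ → CSOmega n t) :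
    sqNorm ((∑ i, Real.sqrt (α i) • (csSketch (ω i) * W i)).mulVec θ) =
      ∑ j, (∑ p : Fin τ × Fin n, csEps ((csEquiv n t τ ω).2 p) *
        (if (csEquiv n t τ ω).1 p = j then 1 else 0) *
        (Real.sqrt (α p.1) * (W p.1).mulVec θ p.2)) ^ 2 := by
  unfold sqNorm
  refine Finset.sum_congr rfl fun j _ => ?_
  congr 1
  rw [Matrix.sum_mulVec, Finset.sum_apply, Fintype.sum_prod_type]
  refine Finset.sum_congr rfl fun i _ => ?_
  rw [Matrix.smul_mulVec, ← Matrix.mulVec_mulVec, Pi.smul_apply, smul_eq_mul]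
  conv_lhs => rw [Matrix.mulVec, dotProduct, Finset.mul_sum]
  refine Finset.sum_congr rfl fun k _ => ?_
  change Real.sqrt (α i) * (((if (ω i).2 k then (1 : ℝ) else -1) *
    (if (ω i).1 k = j then 1 else 0)) * (W i).mulVec θ k) =
    (if (ω i).2 k then (1 : ℝ) else -1) * (if (ω i).1 k = j then 1 else 0) *
    (Real.sqrt (α i) * (W i).mulVec θ k)
  ring

/-- **Corollary (sketched quadratic form approximates the aggregated importance matrix).**
With the aggregated sketch `W̃_τ = Σᵢ √αᵢ SᵢWᵢ` and the aggregated importance matrix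
`Ω̃_τ = Σᵢ αᵢ WᵢᵀWᵢ`, for any fixed `θ ∈ ℝ^m`, with probability at least `0.99`,
`|‖W̃_τ θ‖₂² − θᵀΩ̃_τθ| ≤ (C/√t)·θᵀΩ̃_τθ` for some absolute constant `C > 0`. -/
theorem countSketch_aggregated_quadratic_form :
    ∃ C : ℝ, 0 < C ∧
      ∀ (n m t τ : ℕ), 0 < t →
        ∀ (W : Fin τ → Matrix (Fin n) (Fin m) ℝ) (α : Fin τ → ℝ), (∀ i, 0 ≤ α i) →
        ∀ θ : Fin m → ℝ,
          0.99 ≤ unifPr (fun ω : Fin τ → CSOmega n t =>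
            |sqNorm ((∑ i, Real.sqrt (α i) • (csSketch (ω i) * W i)).mulVec θ)
                - θ ⬝ᵥ ((∑ i, α i • ((W i)ᵀ * W i)).mulVec θ)|
              ≤ (C / Real.sqrt t) * (θ ⬝ᵥ ((∑ i, α i • ((W i)ᵀ * W i)).mulVec θ))) := by
  refine ⟨15, by norm_num, ?_⟩
  intro n m t τ ht W α hα θ
  have : NeZero t := ⟨ht.ne'⟩
  have htr : (0 : ℝ) < t := by exact_mod_cast ht
  have : Nonempty (Fin τ → CSOmega n t) := ⟨fun _ => (fun _ => 0, fun _ => true)⟩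
  refine cs_cheb (Ω := Fin τ → CSOmega n t) _ (t : ℝ) _ htr ?_ ?_
  · rw [cs_quadform W α hα θ]
    exact Finset.sum_nonneg fun p _ => sq_nonneg _
  · rw [cs_quadform W α hα θ]
    simp only [cs_sketchform]
    have h := cs_second_s3 ht (fun p : Fin τ × Fin n => Real.sqrt (α p.1) * (W p.1).mulVec θ p.2)
    rw [← Equiv.sum_comp (csEquiv n t τ), ← Fintype.card_congr (csEquiv n t τ)] at h
    exact h
end

section
/- Let y₁, …, y_τ ∈ ℝ^n be fixed vectors and let S₁, …, S_τ ∈ ℝ^{t×n} be mutually independent CountSketch matrices of sketch size t. Then the second moment of the error random variable is bounded as E[(‖Σ_{k=1}^τ S_k·y_k‖₂² − Σ_{k=1}^τ ‖S_k·y_k‖₂²)²] ≤ (2/t)·(Σ_{k=1}^τ ‖y_k‖₂²)². In particular, since this random variable has mean zero, its variance is at most (2/t)·(Σ_{k=1}^τ ‖y_k‖₂²)². -/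
open Finset Matrix

def sgnB (b : Bool) : ℝ := if b then 1 else -1

lemma sgnB_not (b : Bool) : sgnB (!b) = - sgnB b := by cases b <;> simp [sgnB]
lemma sgnB_sq (b : Bool) : sgnB b * sgnB b = 1 := by cases b <;> simp [sgnB]

def flipE {I : Type*} [DecidableEq I] (p : I) : (I → Bool) ≃ (I → Bool) :=
  Equiv.piCongrRight (fun i => if i = p then Equiv.boolNot else Equiv.refl _)

lemma flipE_same {I : Type*} [DecidableEq I] (p : I) (s : I → Bool) :
    sgnB (flipE p s p) = - sgnB (s p) := by
  simp [flipE, sgnB_not]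

lemma flipE_ne {I : Type*} [DecidableEq I] (p q : I) (h : q ≠ p) (s : I → Bool) :
    flipE p s q = s q := by
  simp [flipE, h]

lemma sum_sgn_zero {I : Type*} [Fintype I] [DecidableEq I] (p : I) (F : (I → Bool) → ℝ)
    (h : ∀ s, F (flipE p s) = - F s) : ∑ s, F s = 0 := by
  have h1 : ∑ s, F (flipE p s) = ∑ s, F s := Equiv.sum_comp (flipE p) F
  simp only [h, Finset.sum_neg_distrib] at h1
  linarith

lemma sum_four {I : Type*} [Fintype I] [DecidableEq I] (p q r u : I) (hpq : p ≠ q) (hru : r ≠ u) :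
    ∑ s : I → Bool, (sgnB (s p) * sgnB (s q)) * (sgnB (s r) * sgnB (s u))
      = (Fintype.card (I → Bool) : ℝ) *
        ((if p = r ∧ q = u then 1 else 0) + (if p = u ∧ q = r then 1 else 0)) := by
  have key : ∀ s : I → Bool, (sgnB (s p) * sgnB (s q)) * (sgnB (s p) * sgnB (s q)) = 1 := by
    intro s
    calc _ = (sgnB (s p) * sgnB (s p)) * (sgnB (s q) * sgnB (s q)) := by ring
      _ = 1 := by simp [sgnB_sq]
  by_cases h1 : p = r
  · subst h1
    by_cases h2 : q = u
    · subst h2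
      simp [key, hpq]
    · simp only [h2, hru, and_false, false_and, if_false, add_zero, mul_zero]
      apply sum_sgn_zero q
      intro s
      rw [flipE_same, flipE_ne q p hpq, flipE_ne q u (Ne.symm h2)]
      ring
  · by_cases h3 : p = u
    · subst h3
      by_cases h2 : q = r
      · subst h2
        simp only [h1, false_and, if_false, and_self, if_true, zero_add, mul_one]
        rw [Finset.sum_congr rfl (g := fun _ => (1 : ℝ))]
        · simp
        · intro s _
          rw [← key s]; ring
      · simp only [h1, h2, and_false, false_and, if_false, add_zero, mul_zero]
        apply sum_sgn_zero q
        intro s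
        rw [flipE_same, flipE_ne q p hpq, flipE_ne q r (Ne.symm h2)]
        ring
    · simp only [h1, h3, false_and, if_false, add_zero, mul_zero]
      apply sum_sgn_zero p
      intro s
      rw [flipE_same, flipE_ne p q hpq.symm, flipE_ne p r (Ne.symm h1), flipE_ne p u (Ne.symm h3)]
      ring

lemma sum_chaos {I : Type*} [Fintype I] [DecidableEq I] (M : I → I → ℝ)
    (hd : ∀ p, M p p = 0) (hs : ∀ p q, M p q = M q p) :
    ∑ s : I → Bool, (∑ p, ∑ q, sgnB (s p) * sgnB (s q) * M p q) ^ 2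
      = (Fintype.card (I → Bool) : ℝ) * (2 * ∑ p, ∑ q, M p q ^ 2) := by
  have h1 : ∀ s : I → Bool, (∑ p, ∑ q, sgnB (s p) * sgnB (s q) * M p q) ^ 2
      = ∑ x : I × I, ∑ z : I × I, M x.1 x.2 * M z.1 z.2 *
        ((sgnB (s x.1) * sgnB (s x.2)) * (sgnB (s z.1) * sgnB (s z.2))) := by
    intro s
    rw [← Fintype.sum_prod_type' (f := fun p q => sgnB (s p) * sgnB (s q) * M p q), sq,
      Finset.sum_mul_sum]
    refine Finset.sum_congr rfl fun x _ => Finset.sum_congr rfl fun z _ => ?_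
    ring
  simp only [h1]
  rw [Finset.sum_comm]
  have h2 : ∀ x : I × I, ∑ s : I → Bool, ∑ z : I × I, M x.1 x.2 * M z.1 z.2 *
        ((sgnB (s x.1) * sgnB (s x.2)) * (sgnB (s z.1) * sgnB (s z.2)))
      = (Fintype.card (I → Bool) : ℝ) * (2 * M x.1 x.2 ^ 2) := by
    intro x
    rw [Finset.sum_comm]
    have h3 : ∀ z : I × I, ∑ s : I → Bool, M x.1 x.2 * M z.1 z.2 *
        ((sgnB (s x.1) * sgnB (s x.2)) * (sgnB (s z.1) * sgnB (s z.2)))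
        = (if z = x then (Fintype.card (I → Bool) : ℝ) * M x.1 x.2 * M z.1 z.2 else 0)
         + (if z = x.swap then (Fintype.card (I → Bool) : ℝ) * M x.1 x.2 * M z.1 z.2 else 0) := by
      intro z
      rw [← Finset.mul_sum]
      by_cases hx : x.1 = x.2
      · simp [hx, hd]
      by_cases hz : z.1 = z.2
      · simp [hz, hd]
      rw [sum_four _ _ _ _ hx hz]
      have e1 : (x.1 = z.1 ∧ x.2 = z.2) ↔ z = x := by
        rw [Prod.ext_iff]; constructor <;> rintro ⟨a, b⟩ <;> exact ⟨a.symm, b.symm⟩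
      have e2 : (x.1 = z.2 ∧ x.2 = z.1) ↔ z = x.swap := by
        rw [Prod.ext_iff]; constructor <;> rintro ⟨a, b⟩ <;> exact ⟨b.symm, a.symm⟩
      simp only [e1, e2]
      split_ifs <;> ring
    simp only [h3, Finset.sum_add_distrib, Finset.sum_ite_eq', Finset.mem_univ, if_true,
      Prod.fst_swap, Prod.snd_swap]
    rw [hs x.2 x.1]; ring
  simp only [h2]
  rw [← Finset.mul_sum, ← Finset.mul_sum, Fintype.sum_prod_type]

lemma sum_coll {I : Type*} [Fintype I] [DecidableEq I] (t : ℕ) [NeZero t] (p q : I) (hpq : p ≠ q) :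
    (t : ℝ) * ∑ h : I → Fin t, (if h p = h q then (1 : ℝ) else 0)
      = (Fintype.card (I → Fin t) : ℝ) := by
  have h1 : ∀ c : Fin t, ∑ h : I → Fin t, (if h p = h q then (1 : ℝ) else 0)
      = ∑ h : I → Fin t, (if c = h q - h p then (1 : ℝ) else 0) := by
    intro c
    rw [← Equiv.sum_comp (Equiv.addRight (Pi.single p c : I → Fin t))]
    refine Finset.sum_congr rfl fun h _ => ?_
    simp only [Equiv.coe_addRight, Pi.add_apply, Pi.single_eq_same, Pi.single_eq_of_ne hpq.symm,
      add_zero]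
    congr 1
    rw [eq_sub_iff_add_eq, add_comm]
  have h2 : ∑ c : Fin t, ∑ h : I → Fin t, (if h p = h q then (1 : ℝ) else 0)
      = (t : ℝ) * ∑ h : I → Fin t, (if h p = h q then (1 : ℝ) else 0) := by
    rw [Finset.sum_const]; simp
  rw [← h2, Finset.sum_congr rfl fun c _ => h1 c, Finset.sum_comm]
  simp

/-- The quadratic form matrix. -/
noncomputable def csM {n t τ : ℕ} (y : Fin τ → Fin n → ℝ) (h : Fin τ × Fin n → Fin t)
    (p q : Fin τ × Fin n) : ℝ :=
  (if p.1 = q.1 then 0 else y p.1 p.2 * y q.1 q.2) * (if h p = h q then 1 else 0)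

lemma err_eq {n t τ : ℕ} (y : Fin τ → Fin n → ℝ) (ω : Fin τ → CSOmega n t) :
    sqNorm (∑ k, (csSketch (ω k)).mulVec (y k))
          - ∑ k, sqNorm ((csSketch (ω k)).mulVec (y k))
    = ∑ p : Fin τ × Fin n, ∑ q : Fin τ × Fin n,
      sgnB ((ω p.1).2 p.2) * sgnB ((ω q.1).2 q.2) *
        csM y (fun p => (ω p.1).1 p.2) p q := by
  set e : Fin t → Fin τ → Fin n → ℝ := fun i k a =>
    sgnB ((ω k).2 a) * (if (ω k).1 a = i then 1 else 0) * y k a with he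
  have h0 : ∀ k i, (csSketch (ω k)).mulVec (y k) i = ∑ a, e i k a := by
    intro k i; rfl
  have h1 : ∀ i, (∑ k, ∑ a, e i k a) ^ 2 = ∑ p : Fin τ × Fin n, ∑ q : Fin τ × Fin n,
      e i p.1 p.2 * e i q.1 q.2 := by
    intro i
    rw [← Fintype.sum_prod_type' (f := e i), sq, Finset.sum_mul_sum]
  have h2 : ∀ i, ∑ k, (∑ a, e i k a) ^ 2 = ∑ p : Fin τ × Fin n, ∑ q : Fin τ × Fin n,
      if p.1 = q.1 then e i p.1 p.2 * e i q.1 q.2 else 0 := by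
    intro i
    rw [Fintype.sum_prod_type]
    refine Finset.sum_congr rfl fun k _ => ?_
    rw [sq, Finset.sum_mul_sum]
    refine Finset.sum_congr rfl fun a _ => ?_
    rw [Fintype.sum_prod_type, Finset.sum_comm]
    simp
  simp only [sqNorm, Finset.sum_apply, h0]
  rw [Finset.sum_comm (s := (Finset.univ : Finset (Fin τ)))]
  simp only [h1, h2]
  rw [← Finset.sum_sub_distrib]
  simp only [← Finset.sum_sub_distrib]
  rw [Finset.sum_comm]
  refine Finset.sum_congr rfl fun p _ => ?_
  rw [Finset.sum_comm]
  refine Finset.sum_congr rfl fun q _ => ?_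
  by_cases hpq : p.1 = q.1
  · simp [csM, hpq]
  · simp only [csM, hpq, if_false, sub_zero, he]
    have : ∀ i, sgnB ((ω p.1).2 p.2) * (if (ω p.1).1 p.2 = i then 1 else 0) * y p.1 p.2 *
        (sgnB ((ω q.1).2 q.2) * (if (ω q.1).1 q.2 = i then 1 else 0) * y q.1 q.2)
        = if (ω p.1).1 p.2 = i then sgnB ((ω p.1).2 p.2) * sgnB ((ω q.1).2 q.2) *
          (y p.1 p.2 * y q.1 q.2 * (if (ω p.1).1 p.2 = (ω q.1).1 q.2 then 1 else 0)) else 0 := by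
      intro i
      by_cases hi : (ω p.1).1 p.2 = i
      · subst hi
        simp only [if_true, eq_comm (a := (ω q.1).1 q.2)]
        ring
      · simp [hi]
    simp only [this, Finset.sum_ite_eq, Finset.mem_univ, if_true]

def omE (n t τ : ℕ) :
    (Fin τ → CSOmega n t) ≃ ((Fin τ × Fin n → Fin t) × (Fin τ × Fin n → Bool)) where
  toFun ω := (fun p => (ω p.1).1 p.2, fun p => (ω p.1).2 p.2)
  invFun x := fun k => (fun a => x.1 (k, a), fun a => x.2 (k, a))
  left_inv _ := rfl
  right_inv _ := rfl

lemma second_moment (n t τ : ℕ) (y : Fin τ → Fin n → ℝ) :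
    unifE (fun ω : Fin τ → CSOmega n t =>
        (sqNorm (∑ k, (csSketch (ω k)).mulVec (y k))
          - ∑ k, sqNorm ((csSketch (ω k)).mulVec (y k))) ^ 2)
      ≤ (2 / (t : ℝ)) * (∑ k, sqNorm (y k)) ^ 2 := by
  rcases Nat.eq_zero_or_pos t with ht | ht
  · subst ht
    simp [unifE, sqNorm]
  have : NeZero t := ⟨ht.ne'⟩
  have ht' : (0 : ℝ) < t := by exact_mod_cast ht
  simp only [err_eq]
  unfold unifE
  rw [Fintype.card_congr (omE n t τ), Fintype.card_prod]
  have hsum : ∑ ω : Fin τ → CSOmega n t, (∑ p : Fin τ × Fin n, ∑ q : Fin τ × Fin n,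
      sgnB ((ω p.1).2 p.2) * sgnB ((ω q.1).2 q.2) *
        csM y (fun p => (ω p.1).1 p.2) p q) ^ 2
      = ∑ x : (Fin τ × Fin n → Fin t) × (Fin τ × Fin n → Bool),
        (∑ p, ∑ q, sgnB (x.2 p) * sgnB (x.2 q) * csM y x.1 p q) ^ 2 :=
    Equiv.sum_comp (omE n t τ) (fun x => (∑ p, ∑ q, sgnB (x.2 p) * sgnB (x.2 q) *
      csM y x.1 p q) ^ 2)
  rw [hsum, Fintype.sum_prod_type]
  have h1 : ∀ h : Fin τ × Fin n → Fin t, ∑ s : Fin τ × Fin n → Bool,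
      (∑ p, ∑ q, sgnB (s p) * sgnB (s q) * csM y h p q) ^ 2
      = (Fintype.card (Fin τ × Fin n → Bool) : ℝ) * (2 * ∑ p, ∑ q, csM y h p q ^ 2) := by
    intro h
    apply sum_chaos
    · intro p; simp [csM]
    · intro p q
      simp only [csM, eq_comm (a := q.1), eq_comm (a := h q), mul_comm (y q.1 q.2)]
  simp only [h1]
  rw [← Finset.mul_sum, ← Finset.mul_sum, Finset.sum_comm]
  have h2 : ∀ p q : Fin τ × Fin n, ∑ h : Fin τ × Fin n → Fin t, csM y h p q ^ 2
      ≤ (Fintype.card (Fin τ × Fin n → Fin t) : ℝ) / t * (y p.1 p.2 ^ 2 * y q.1 q.2 ^ 2) := by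
    intro p q
    by_cases hpq : p.1 = q.1
    · simp only [csM, hpq, if_true, zero_mul]
      simp only [ne_eq, OfNat.ofNat_ne_zero, not_false_eq_true, zero_pow, Finset.sum_const_zero]
      positivity
    · have hne : p ≠ q := fun h => hpq (by rw [h])
      rw [← sum_coll t p q hne]
      simp only [csM, hpq, if_false, mul_pow, ite_pow, one_pow]
      rw [← Finset.mul_sum, mul_div_cancel_left₀ _ ht'.ne']
      simp [mul_comm]
  have h3 : ∑ p : Fin τ × Fin n, ∑ h : Fin τ × Fin n → Fin t, ∑ q, csM y h p q ^ 2
      ≤ (Fintype.card (Fin τ × Fin n → Fin t) : ℝ) / t * (∑ k, sqNorm (y k)) ^ 2 := by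
    have : ∑ k, sqNorm (y k) = ∑ p : Fin τ × Fin n, y p.1 p.2 ^ 2 := by
      rw [Fintype.sum_prod_type]; rfl
    rw [this, sq (∑ p : Fin τ × Fin n, y p.1 p.2 ^ 2), Finset.sum_mul_sum, Finset.mul_sum]
    refine Finset.sum_le_sum fun p _ => ?_
    rw [Finset.sum_comm, Finset.mul_sum]
    exact Finset.sum_le_sum fun q _ => h2 p q
  have hb : (0 : ℝ) < (Fintype.card (Fin τ × Fin n → Bool) : ℝ) := by
    exact_mod_cast Fintype.card_pos
  have hc : (0 : ℝ) < (Fintype.card (Fin τ × Fin n → Fin t) : ℝ) := by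
    exact_mod_cast Fintype.card_pos
  rw [Nat.cast_mul]
  rw [div_le_iff₀ (by positivity)]
  calc _ ≤ (Fintype.card (Fin τ × Fin n → Bool) : ℝ) * (2 *
        ((Fintype.card (Fin τ × Fin n → Fin t) : ℝ) / t * (∑ k, sqNorm (y k)) ^ 2)) := by
        gcongr
    _ = _ := by ring

/-- **Lemma (variance bound for the aggregation error).**
For fixed vectors `y₁,…,y_τ ∈ ℝ^n` and mutually independent CountSketch matrices
`S₁,…,S_τ ∈ ℝ^{t×n}`, the error `‖Σ_k S_k y_k‖₂² − Σ_k ‖S_k y_k‖₂²` has second moment at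
most `(2/t)·(Σ_k ‖y_k‖₂²)²`; in particular (since it has mean zero) its variance is at
most `(2/t)·(Σ_k ‖y_k‖₂²)²`. -/
theorem countSketch_aggregation_error_variance (n t τ : ℕ) (y : Fin τ → Fin n → ℝ) :
    unifE (fun ω : Fin τ → CSOmega n t =>
        (sqNorm (∑ k, (csSketch (ω k)).mulVec (y k))
          - ∑ k, sqNorm ((csSketch (ω k)).mulVec (y k))) ^ 2)
      ≤ (2 / (t : ℝ)) * (∑ k, sqNorm (y k)) ^ 2 ∧
    unifE (fun ω : Fin τ → CSOmega n t =>
        (sqNorm (∑ k, (csSketch (ω k)).mulVec (y k))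
          - ∑ k, sqNorm ((csSketch (ω k)).mulVec (y k))) ^ 2)
      - (unifE (fun ω : Fin τ → CSOmega n t =>
          sqNorm (∑ k, (csSketch (ω k)).mulVec (y k))
            - ∑ k, sqNorm ((csSketch (ω k)).mulVec (y k)))) ^ 2
      ≤ (2 / (t : ℝ)) * (∑ k, sqNorm (y k)) ^ 2 := by
  have h := second_moment n t τ y
  refine ⟨h, ?_⟩
  refine le_trans (sub_le_self _ (sq_nonneg _)) h
end
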